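/- Consider the Liebscher copula C̃ built from bivariate copulas C₁,…,C_K. Assume each g_j^{(k)} (j ∈ {1,2}, k ∈ {1,…,K}) is differentiable at 1 with derivative d_j^{(k)}, and that for each k the upper tail dependence function Λ^U_k(x,y) := x + y + lim_{ε→0⁺} (C_k(1−εx, 1−εy) − 1)/ε exists for all x, y ≥ 0. Then necessarily ∑_{k=1}^K d_j^{(k)} = 1 for j = 1, 2, and for all x, y ≥ 0 the limit x + y + lim_{ε→0⁺} (C̃(1−εx, 1−εy) − 1)/ε exists and equals ∑_{k=1}^K Λ^U_k(d_1^{(k)} x, d_2^{(k)} y). -/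

import Mathlib

open Set Filter

/-- A bivariate copula: maps `[0,1]²` into `[0,1]`, has the copula boundary conditions,
and is 2-increasing. -/
def IsCopula2 (C : ℝ → ℝ → ℝ) : Prop :=
  (∀ u ∈ Set.Icc (0:ℝ) 1, ∀ v ∈ Set.Icc (0:ℝ) 1, C u v ∈ Set.Icc (0:ℝ) 1) ∧
  (∀ u ∈ Set.Icc (0:ℝ) 1, C u 0 = 0) ∧
  (∀ v ∈ Set.Icc (0:ℝ) 1, C 0 v = 0) ∧
  (∀ u ∈ Set.Icc (0:ℝ) 1, C u 1 = u) ∧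
  (∀ v ∈ Set.Icc (0:ℝ) 1, C 1 v = v) ∧
  (∀ u₁ u₂ v₁ v₂ : ℝ, 0 ≤ u₁ → u₁ ≤ u₂ → u₂ ≤ 1 → 0 ≤ v₁ → v₁ ≤ v₂ → v₂ ≤ 1 →
    0 ≤ C u₂ v₂ - C u₂ v₁ - C u₁ v₂ + C u₁ v₁)

/-- The data of Liebscher's construction: bivariate copulas `C₁,…,C_K` together with
monotone increasing functions `g_j^{(k)} : [0,1] → [0,1]` (j = 1,2) with `g_j^{(k)}(0)=0`,
`g_j^{(k)}(1)=1` and `∏_k g_j^{(k)}(u) = u` on `[0,1]`. -/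
structure LiebscherSetup (K : ℕ) where
  C : Fin K → ℝ → ℝ → ℝ
  g₁ : Fin K → ℝ → ℝ
  g₂ : Fin K → ℝ → ℝ
  copula : ∀ k, IsCopula2 (C k)
  mono₁ : ∀ k, MonotoneOn (g₁ k) (Set.Icc 0 1)
  mono₂ : ∀ k, MonotoneOn (g₂ k) (Set.Icc 0 1)
  maps₁ : ∀ k, Set.MapsTo (g₁ k) (Set.Icc 0 1) (Set.Icc 0 1)
  maps₂ : ∀ k, Set.MapsTo (g₂ k) (Set.Icc 0 1) (Set.Icc 0 1)
  zero₁ : ∀ k, g₁ k 0 = 0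
  zero₂ : ∀ k, g₂ k 0 = 0
  one₁ : ∀ k, g₁ k 1 = 1
  one₂ : ∀ k, g₂ k 1 = 1
  prodId₁ : ∀ u ∈ Set.Icc (0:ℝ) 1, ∏ k, g₁ k u = u
  prodId₂ : ∀ u ∈ Set.Icc (0:ℝ) 1, ∏ k, g₂ k u = u

/-- The Liebscher copula `C̃(u,v) = ∏_k C_k(g₁^{(k)}(u), g₂^{(k)}(v))`. -/
def LiebscherSetup.Ct {K : ℕ} (L : LiebscherSetup K) (u v : ℝ) : ℝ :=
  ∏ k, L.C k (L.g₁ k u) (L.g₂ k v)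

/-- A copula is increasing and `1`-Lipschitz in its first argument. -/
theorem IsCopula2.sub_left_mem {C : ℝ → ℝ → ℝ} (hC : IsCopula2 C) {u₁ u₂ v : ℝ}
    (h0 : 0 ≤ u₁) (h : u₁ ≤ u₂) (h1 : u₂ ≤ 1) (hv : v ∈ Set.Icc (0:ℝ) 1) :
    0 ≤ C u₂ v - C u₁ v ∧ C u₂ v - C u₁ v ≤ u₂ - u₁ := by
  obtain ⟨-, hz, -, ho, -, hinc⟩ := hC
  have m₁ : u₁ ∈ Set.Icc (0:ℝ) 1 := ⟨h0, h.trans h1⟩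
  have m₂ : u₂ ∈ Set.Icc (0:ℝ) 1 := ⟨h0.trans h, h1⟩
  have hlow := hinc u₁ u₂ 0 v h0 h h1 le_rfl hv.1 hv.2
  have hupp := hinc u₁ u₂ v 1 h0 h h1 hv.1 hv.2 le_rfl
  rw [hz _ m₁, hz _ m₂] at hlow
  rw [ho _ m₁, ho _ m₂] at hupp
  constructor <;> linarith

/-- The transpose of a copula is a copula. -/
theorem IsCopula2.swap {C : ℝ → ℝ → ℝ} (hC : IsCopula2 C) :
    IsCopula2 (fun u v => C v u) := by
  obtain ⟨hm, hz, hz', ho, ho', hinc⟩ := hC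
  refine ⟨fun u hu v hv => hm v hv u hu, hz', hz, ho', ho, ?_⟩
  intro u₁ u₂ v₁ v₂ hu₁ hu hu₂ hv₁ hv hv₂
  have := hinc v₁ v₂ u₁ u₂ hv₁ hv hv₂ hu₁ hu hu₂
  linarith

theorem IsCopula2.abs_sub_left_le {C : ℝ → ℝ → ℝ} (hC : IsCopula2 C) {u u' v : ℝ}
    (hu : u ∈ Set.Icc (0:ℝ) 1) (hu' : u' ∈ Set.Icc (0:ℝ) 1) (hv : v ∈ Set.Icc (0:ℝ) 1) :
    |C u v - C u' v| ≤ |u - u'| := by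
  rcases le_total u u' with h | h
  · obtain ⟨h₁, h₂⟩ := hC.sub_left_mem hu.1 h hu'.2 hv
    rwa [abs_sub_comm, abs_sub_comm u, abs_of_nonneg h₁, abs_of_nonneg (sub_nonneg.2 h)]
  · obtain ⟨h₁, h₂⟩ := hC.sub_left_mem hu'.1 h hu.2 hv
    rwa [abs_of_nonneg h₁, abs_of_nonneg (sub_nonneg.2 h)]

/-- A copula is `1`-Lipschitz for the `ℓ¹` distance. -/
theorem IsCopula2.abs_sub_le {C : ℝ → ℝ → ℝ} (hC : IsCopula2 C) {u u' v v' : ℝ}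
    (hu : u ∈ Set.Icc (0:ℝ) 1) (hu' : u' ∈ Set.Icc (0:ℝ) 1)
    (hv : v ∈ Set.Icc (0:ℝ) 1) (hv' : v' ∈ Set.Icc (0:ℝ) 1) :
    |C u v - C u' v'| ≤ |u - u'| + |v - v'| :=
  (_root_.abs_sub_le _ (C u' v) _).trans
    (add_le_add (hC.abs_sub_left_le hu hu' hv) (hC.swap.abs_sub_left_le hv hv' hu'))

theorem eventually_one_sub_mul_mem_Icc {x : ℝ} (hx : 0 ≤ x) :
    ∀ᶠ ε : ℝ in nhdsWithin 0 (Set.Ioi 0), 1 - ε * x ∈ Set.Icc (0:ℝ) 1 := by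
  have hlt : ∀ᶠ ε : ℝ in nhdsWithin 0 (Set.Ioi 0), ε * x < 1 := by
    have hcont : Continuous fun ε : ℝ => ε * x := by fun_prop
    exact nhdsWithin_le_nhds ((hcont.tendsto 0).eventually_lt_const (by simp))
  filter_upwards [hlt, self_mem_nhdsWithin] with ε h₁ h₂
  have := mul_nonneg (le_of_lt h₂) hx
  constructor <;> linarith

/-- First-order expansion at `1` along the ray `ε ↦ 1 - ε * x`. -/
theorem tendsto_sub_div_of_hasDerivWithinAt_one {g : ℝ → ℝ} {d x : ℝ} (hg : g 1 = 1)
    (hd : HasDerivWithinAt g d (Set.Icc 0 1) 1) (hx : 0 ≤ x) :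
    Tendsto (fun ε => (g (1 - ε * x) - (1 - ε * (d * x))) / ε)
      (nhdsWithin 0 (Set.Ioi 0)) (nhds 0) := by
  have hlin : HasDerivAt (fun ε : ℝ => 1 - ε * x) (-x) 0 := by
    simpa using ((hasDerivAt_id (0:ℝ)).mul_const x).const_sub 1
  have hcomp : HasDerivWithinAt (fun ε => g (1 - ε * x)) (d * -x)
      (Set.Ioi 0 ∩ {ε | 1 - ε * x ∈ Set.Icc (0:ℝ) 1}) 0 := by
    refine HasDerivWithinAt.comp (h₂ := g) (h := fun ε : ℝ => 1 - ε * x) (s' := Set.Icc 0 1) 0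
      (by simpa using hd) hlin.hasDerivWithinAt fun ε hε => hε.2
  have hIoi : HasDerivWithinAt (fun ε => g (1 - ε * x)) (d * -x) (Set.Ioi 0) 0 :=
    hcomp.mono_of_mem_nhdsWithin
      (inter_mem self_mem_nhdsWithin (eventually_one_sub_mul_mem_Icc hx))
  rw [hasDerivWithinAt_iff_tendsto_slope' (by simp)] at hIoi
  have := hIoi.add_const (d * x)
  rw [mul_neg, neg_add_cancel] at this
  refine this.congr' ?_
  filter_upwards [self_mem_nhdsWithin] with ε hε
  have hε' : ε ≠ 0 := ne_of_gt hε
  simp only [slope_def_field, zero_mul, sub_zero, hg]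
  field_simp
  ring

theorem HasDerivWithinAt.finsetProd_of_eq_one {ι : Type*} [Fintype ι] {f : ι → ℝ → ℝ}
    {f' : ι → ℝ} {s : Set ℝ} {a : ℝ} (hf : ∀ i, HasDerivWithinAt (f i) (f' i) s a)
    (h1 : ∀ i, f i a = 1) :
    HasDerivWithinAt (fun t => ∏ i, f i t) (∑ i, f' i) s a := by
  classical
  have := HasDerivWithinAt.fun_finsetProd (u := Finset.univ) fun i _ => hf i
  simpa [h1] using this

theorem sum_deriv_eq_one_of_prod_eq_id {ι : Type*} [Fintype ι] {g : ι → ℝ → ℝ} {d : ι → ℝ}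
    (hg : ∀ i, g i 1 = 1) (hprod : ∀ u ∈ Set.Icc (0:ℝ) 1, ∏ i, g i u = u)
    (hd : ∀ i, HasDerivWithinAt (g i) (d i) (Set.Icc 0 1) 1) : ∑ i, d i = 1 := by
  have h1 : (1:ℝ) ∈ Set.Icc (0:ℝ) 1 := by simp
  have hid : HasDerivWithinAt (fun t => ∏ i, g i t) 1 (Set.Icc 0 1) 1 :=
    (hasDerivWithinAt_id _ _).congr hprod (hprod 1 h1)
  exact (uniqueDiffOn_Icc zero_lt_one 1 h1).eq_deriv _
    (HasDerivWithinAt.finsetProd_of_eq_one hd hg) hid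

theorem MonotoneOn.nonneg_of_hasDerivWithinAt_one {g : ℝ → ℝ} {d : ℝ}
    (hg : MonotoneOn g (Set.Icc 0 1)) (hd : HasDerivWithinAt g d (Set.Icc 0 1) 1) : 0 ≤ d := by
  rw [← hd.derivWithin (uniqueDiffOn_Icc zero_lt_one 1 (by simp))]
  exact hg.derivWithin_nonneg

/-- Chain rule for the upper tail expansion of a copula with transformed margins. -/
theorem IsCopula2.hasDerivWithinAt_comp_margins {C : ℝ → ℝ → ℝ} (hC : IsCopula2 C)
    {g₁ g₂ : ℝ → ℝ} {d₁ d₂ x y l : ℝ}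
    (hmaps₁ : Set.MapsTo g₁ (Set.Icc 0 1) (Set.Icc 0 1))
    (hmaps₂ : Set.MapsTo g₂ (Set.Icc 0 1) (Set.Icc 0 1))
    (hone₁ : g₁ 1 = 1) (hone₂ : g₂ 1 = 1)
    (hd₁ : HasDerivWithinAt g₁ d₁ (Set.Icc 0 1) 1)
    (hd₂ : HasDerivWithinAt g₂ d₂ (Set.Icc 0 1) 1)
    (hd₁0 : 0 ≤ d₁) (hd₂0 : 0 ≤ d₂) (hx : 0 ≤ x) (hy : 0 ≤ y)
    (hl : Tendsto (fun ε => (C (1 - ε * (d₁ * x)) (1 - ε * (d₂ * y)) - 1) / ε)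
      (nhdsWithin 0 (Set.Ioi 0)) (nhds l)) :
    HasDerivWithinAt (fun ε => C (g₁ (1 - ε * x)) (g₂ (1 - ε * y))) l (Set.Ioi 0) 0 := by
  have hC1 : C 1 1 = 1 := hC.2.2.2.1 1 (by simp)
  rw [hasDerivWithinAt_iff_tendsto_slope' (by simp)]
  have hbound := (tendsto_sub_div_of_hasDerivWithinAt_one hone₁ hd₁ hx).abs.add
    (tendsto_sub_div_of_hasDerivWithinAt_one hone₂ hd₂ hy).abs
  rw [abs_zero, add_zero] at hbound
  have hdiff : Tendsto (fun ε => (C (g₁ (1 - ε * x)) (g₂ (1 - ε * y)) -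
      C (1 - ε * (d₁ * x)) (1 - ε * (d₂ * y))) / ε) (nhdsWithin 0 (Set.Ioi 0)) (nhds 0) := by
    refine squeeze_zero_norm' ?_ hbound
    filter_upwards [eventually_one_sub_mul_mem_Icc hx, eventually_one_sub_mul_mem_Icc hy,
      eventually_one_sub_mul_mem_Icc (mul_nonneg hd₁0 hx),
      eventually_one_sub_mul_mem_Icc (mul_nonneg hd₂0 hy)] with ε h₁ h₂ h₃ h₄
    rw [Real.norm_eq_abs, abs_div, abs_div, abs_div, ← add_div]
    gcongr
    exact hC.abs_sub_le (hmaps₁ h₁) h₃ (hmaps₂ h₂) h₄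
  have hsum := hdiff.add hl
  rw [zero_add] at hsum
  refine hsum.congr fun ε => ?_
  simp only [slope_def_field, zero_mul, sub_zero, hone₁, hone₂, hC1]
  rw [← add_div]
  ring

/-- **Upper tail dependence function of a Liebscher copula, general case.**
If each `g_j^{(k)}` is differentiable at 1 (within `[0,1]`) with derivative `d_j^{(k)}`,
and each `C_k` admits an upper tail dependence function
`Λ^U_k(x,y) = x + y + lim_{ε→0⁺} (C_k(1−εx,1−εy)−1)/ε`, then `∑_k d_j^{(k)} = 1` for
`j = 1,2` and the upper tail dependence function of `C̃` is
`(x,y) ↦ ∑_k Λ^U_k(d₁^{(k)} x, d₂^{(k)} y)`. -/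
theorem liebscher_upper_tail_general (K : ℕ) (hK : 1 ≤ K) (L : LiebscherSetup K)
    (d₁ d₂ : Fin K → ℝ)
    (hd₁ : ∀ k, HasDerivWithinAt (L.g₁ k) (d₁ k) (Set.Icc 0 1) 1)
    (hd₂ : ∀ k, HasDerivWithinAt (L.g₂ k) (d₂ k) (Set.Icc 0 1) 1)
    (ΛU : Fin K → ℝ → ℝ → ℝ)
    (hΛU : ∀ k, ∀ x ≥ (0:ℝ), ∀ y ≥ (0:ℝ),
      Filter.Tendsto (fun ε => (L.C k (1 - ε * x) (1 - ε * y) - 1) / ε)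
        (nhdsWithin 0 (Set.Ioi 0)) (nhds (ΛU k x y - x - y))) :
    ((∑ k, d₁ k = 1) ∧ (∑ k, d₂ k = 1)) ∧
    ∀ x ≥ (0:ℝ), ∀ y ≥ (0:ℝ),
      Filter.Tendsto (fun ε => (L.Ct (1 - ε * x) (1 - ε * y) - 1) / ε)
        (nhdsWithin 0 (Set.Ioi 0))
        (nhds ((∑ k, ΛU k (d₁ k * x) (d₂ k * y)) - x - y)) := by
  have hsum₁ := sum_deriv_eq_one_of_prod_eq_id L.one₁ L.prodId₁ hd₁
  have hsum₂ := sum_deriv_eq_one_of_prod_eq_id L.one₂ L.prodId₂ hd₂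
  refine ⟨⟨hsum₁, hsum₂⟩, fun x hx y hy => ?_⟩
  have hnonneg₁ k := (L.mono₁ k).nonneg_of_hasDerivWithinAt_one (hd₁ k)
  have hnonneg₂ k := (L.mono₂ k).nonneg_of_hasDerivWithinAt_one (hd₂ k)
  have hC1 k : L.C k 1 1 = 1 := (L.copula k).2.2.2.1 1 (by simp)
  have hprod := HasDerivWithinAt.finsetProd_of_eq_one
    (fun k => (L.copula k).hasDerivWithinAt_comp_margins (L.maps₁ k) (L.maps₂ k)
      (L.one₁ k) (L.one₂ k) (hd₁ k) (hd₂ k) (hnonneg₁ k) (hnonneg₂ k) hx hy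
      (hΛU k _ (mul_nonneg (hnonneg₁ k) hx) _ (mul_nonneg (hnonneg₂ k) hy)))
    (fun k => by simp [L.one₁, L.one₂, hC1])
  rw [hasDerivWithinAt_iff_tendsto_slope' (by simp), Finset.sum_sub_distrib,
    Finset.sum_sub_distrib, ← Finset.sum_mul, ← Finset.sum_mul, hsum₁, hsum₂, one_mul,
    one_mul] at hprod
  refine hprod.congr fun ε => ?_
  simp [slope_def_field, LiebscherSetup.Ct, L.one₁, L.one₂, hC1]
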